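/- Let k ≥ 2 and suppose τ > 0 satisfies τ·‖X_k‖·‖M‖²·s(B^k)² < 1. Then the equation (λ − 1)‖y‖² + τλ·⟨Mᵀ[λI − (Bᵀ)^k]⁻¹[(λ − 1)X_k + T_kᵀHᵀH T_k](λI − B^k)⁻¹M y, y⟩ = 0 has no solution with λ ∈ ℝ, λ ≠ 1, |λ| ≥ 1 and y ∈ ℂ^{n_σ}, y ≠ 0. Moreover, if ‖B‖ < 1, it suffices that τ < ((1 − ‖B‖)²/(‖H‖²‖M‖²)) · (1 − ‖B‖^k)² / (1 − k‖B‖^{k−1} + (k−1)‖B‖^k). -/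

import Mathlib

open Matrix

variable {nu nσ nf : ℕ}

/-- Operator norm induced by the Euclidean norms. -/
noncomputable def opNorm {𝕜 : Type*} [RCLike 𝕜] {m n : ℕ} (A : Matrix (Fin m) (Fin n) 𝕜) : ℝ :=
  ‖LinearMap.toContinuousLinearMap (Matrix.toEuclideanLin A)‖

/-- `s(T) = sup_{z ∈ ℂ, |z| ≥ 1} ‖(I − T/z)⁻¹‖`. -/
noncomputable def sSB {n : ℕ} (T : Matrix (Fin n) (Fin n) ℂ) : ℝ :=
  sSup {r : ℝ | ∃ z : ℂ, 1 ≤ ‖z‖ ∧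
    r = opNorm ((1 : Matrix (Fin n) (Fin n) ℂ) - z⁻¹ • T)⁻¹}

/-- `T_k = I + B + ... + B^{k−1}`. -/
noncomputable def Tmat (B : Matrix (Fin nu) (Fin nu) ℝ) (k : ℕ) :
    Matrix (Fin nu) (Fin nu) ℝ :=
  ∑ j ∈ Finset.range k, B ^ j

/-- `U_k = Σ_{i+j=k−1} (Bᵀ)^i HᵀH B^j`. -/
noncomputable def Umat (B : Matrix (Fin nu) (Fin nu) ℝ) (H : Matrix (Fin nf) (Fin nu) ℝ)
    (k : ℕ) : Matrix (Fin nu) (Fin nu) ℝ :=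
  ∑ i ∈ Finset.range k, (Bᵀ) ^ i * (Hᵀ * H) * B ^ (k - 1 - i)

/-- `X_k = Σ_{l=1}^{k−1} U_l` (so `X₁ = 0`). -/
noncomputable def Xmat (B : Matrix (Fin nu) (Fin nu) ℝ) (H : Matrix (Fin nf) (Fin nu) ℝ)
    (k : ℕ) : Matrix (Fin nu) (Fin nu) ℝ :=
  ∑ l ∈ Finset.Ico 1 k, Umat B H l

section L2OperatorNorm

open scoped Matrix.Norms.L2Operator

theorem opNorm_eq_norm {𝕜 : Type*} [RCLike 𝕜] {m n : ℕ} (A : Matrix (Fin m) (Fin n) 𝕜) :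
    opNorm A = ‖A‖ := rfl

theorem norm_toLp_mulVec_le {𝕜 : Type*} [RCLike 𝕜] {m n : ℕ} (A : Matrix (Fin m) (Fin n) 𝕜)
    (v : Fin n → 𝕜) : ‖WithLp.toLp 2 (A *ᵥ v)‖ ≤ ‖A‖ * ‖WithLp.toLp 2 v‖ :=
  l2_opNorm_mulVec A (WithLp.toLp 2 v)

theorem norm_one_le_one {𝕜 : Type*} [RCLike 𝕜] {n : ℕ} :
    ‖(1 : Matrix (Fin n) (Fin n) 𝕜)‖ ≤ 1 := by
  have h := CStarRing.norm_star_mul_self (x := (1 : Matrix (Fin n) (Fin n) 𝕜))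
  rw [star_one, one_mul] at h
  nlinarith [norm_nonneg (1 : Matrix (Fin n) (Fin n) 𝕜)]

/-- Complexification does not increase the operator norm of a real matrix. -/
theorem norm_map_ofReal_le {m n : ℕ} (A : Matrix (Fin m) (Fin n) ℝ) :
    ‖A.map Complex.ofReal‖ ≤ ‖A‖ := by
  rw [l2_opNorm_def]
  refine ContinuousLinearMap.opNorm_le_bound _ (norm_nonneg A) fun x => ?_
  change ‖WithLp.toLp 2 ((A.map Complex.ofReal) *ᵥ x.ofLp)‖ ≤ _
  have hre := norm_toLp_mulVec_le A (fun i => (x i).re)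
  have him := norm_toLp_mulVec_le A (fun i => (x i).im)
  have hsplit : ∀ {l : ℕ} (v : Fin l → ℂ), ‖WithLp.toLp 2 v‖ ^ 2 =
      ‖WithLp.toLp 2 (fun i => (v i).re)‖ ^ 2 + ‖WithLp.toLp 2 (fun i => (v i).im)‖ ^ 2 := by
    intro l v
    simp only [EuclideanSpace.norm_sq_eq, ← Finset.sum_add_distrib]
    refine Finset.sum_congr rfl fun i _ => ?_
    rw [← Complex.normSq_eq_norm_sq, Complex.normSq_apply, Real.norm_eq_abs, Real.norm_eq_abs,
      sq_abs, sq_abs]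
    ring
  have e1 : (fun i => (((A.map Complex.ofReal) *ᵥ x.ofLp) i).re) =
      A *ᵥ (fun i => (x i).re) := by
    ext i
    simp [mulVec, dotProduct]
  have e2 : (fun i => (((A.map Complex.ofReal) *ᵥ x.ofLp) i).im) =
      A *ᵥ (fun i => (x i).im) := by
    ext i
    simp [mulVec, dotProduct]
  have h1 := hsplit ((A.map Complex.ofReal) *ᵥ x.ofLp)
  have h2 : ‖x‖ ^ 2 = _ := hsplit x.ofLp
  rw [e1, e2] at h1
  refine (sq_le_sq₀ (norm_nonneg _) (by positivity)).1 ?_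
  rw [h1, mul_pow, h2, mul_add, ← mul_pow, ← mul_pow]
  gcongr

theorem star_dotProduct_self_eq {n : ℕ} (v : Fin n → ℂ) :
    star v ⬝ᵥ v = ((‖WithLp.toLp 2 v‖ ^ 2 : ℝ) : ℂ) := by
  rw [EuclideanSpace.norm_sq_eq]
  simp only [dotProduct, Pi.star_apply, Complex.ofReal_sum]
  refine Finset.sum_congr rfl fun i _ => ?_
  rw [← Complex.normSq_eq_norm_sq, Complex.star_def, Complex.normSq_eq_conj_mul_self]

theorem norm_star_dotProduct_mulVec_le {n : ℕ} (A : Matrix (Fin n) (Fin n) ℂ) (v : Fin n → ℂ) :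
    ‖star v ⬝ᵥ A *ᵥ v‖ ≤ ‖A‖ * ‖WithLp.toLp 2 v‖ ^ 2 := by
  have h : star v ⬝ᵥ A *ᵥ v = inner ℂ (WithLp.toLp 2 v) (WithLp.toLp 2 (A *ᵥ v)) := by
    rw [EuclideanSpace.inner_eq_star_dotProduct, dotProduct_comm]
  rw [h]
  refine (norm_inner_le_norm _ _).trans ?_
  nlinarith [norm_toLp_mulVec_le A v, norm_nonneg (WithLp.toLp 2 v)]

theorem inv_sub_eq_smul_inv {n : ℕ} {C : Matrix (Fin n) (Fin n) ℂ} {z : ℂ} (hz : z ≠ 0)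
    (hu : IsUnit (1 - z⁻¹ • C)) : (z • 1 - C)⁻¹ = z⁻¹ • (1 - z⁻¹ • C)⁻¹ := by
  apply inv_eq_right_inv
  have h : z • 1 - C = z • (1 - z⁻¹ • C) := by
    rw [smul_sub, smul_smul, mul_inv_cancel₀ hz, one_smul]
  rw [h, smul_mul_smul_comm, mul_inv_cancel₀ hz, one_smul,
    mul_nonsing_inv _ ((isUnit_iff_isUnit_det _).1 hu)]

/-- The eigenvalue equation, for complex matrices, has no real solution outside the open unit
disk other than `1`, given a resolvent bound `s`. -/
theorem eigenvalue_expr_ne_zero {p q r : ℕ} (C X : Matrix (Fin p) (Fin p) ℂ)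
    (M : Matrix (Fin p) (Fin q) ℂ) (G : Matrix (Fin r) (Fin p) ℂ) {s τ lam : ℝ}
    (hu : ∀ w : ℂ, ‖w‖ ≤ 1 → IsUnit (1 - w • C))
    (hs : ∀ z : ℂ, 1 ≤ ‖z‖ → ‖(1 - z⁻¹ • C)⁻¹‖ ≤ s) (hτ : 0 < τ)
    (hb : τ * (‖X‖ * ‖M‖ ^ 2 * s ^ 2) < 1) (h1 : lam ≠ 1) (hlam : 1 ≤ |lam|)
    {y : Fin q → ℂ} (hy : y ≠ 0) :
    ((lam : ℂ) - 1) * (star y ⬝ᵥ y) + (τ : ℂ) * (lam : ℂ) * (star y ⬝ᵥ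
      ((Mᴴ * ((lam : ℂ) • (1 : Matrix (Fin p) (Fin p) ℂ) - Cᴴ)⁻¹ *
        (((lam : ℂ) - 1) • X + Gᴴ * G) *
        ((lam : ℂ) • (1 : Matrix (Fin p) (Fin p) ℂ) - C)⁻¹ * M) *ᵥ y)) ≠ 0 := by
  have hl0 : lam ≠ 0 := by
    rintro rfl
    norm_num at hlam
  have hlc : (lam : ℂ) ≠ 0 := by exact_mod_cast hl0
  have hlz : 1 ≤ ‖(lam : ℂ)‖ := by rwa [Complex.norm_real]
  set R := ((lam : ℂ) • (1 : Matrix (Fin p) (Fin p) ℂ) - C)⁻¹ with hR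
  have hRH : ((lam : ℂ) • (1 : Matrix (Fin p) (Fin p) ℂ) - Cᴴ)⁻¹ = Rᴴ := by
    rw [hR, conjTranspose_nonsing_inv, conjTranspose_sub, conjTranspose_smul, conjTranspose_one]
    simp
  set w := R *ᵥ (M *ᵥ y) with hw
  have hform : star y ⬝ᵥ ((Mᴴ * Rᴴ * (((lam : ℂ) - 1) • X + Gᴴ * G) * R * M) *ᵥ y) =
      ((lam : ℂ) - 1) * (star w ⬝ᵥ X *ᵥ w) + ((‖WithLp.toLp 2 (G *ᵥ w)‖ ^ 2 : ℝ) : ℂ) := by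
    rw [← star_dotProduct_self_eq, hw]
    simp only [star_mulVec, ← mulVec_mulVec, add_mulVec, dotProduct_add, smul_mulVec,
      dotProduct_smul, dotProduct_mulVec, smul_eq_mul, mulVec_add, mulVec_smul]
  rw [hRH, hform, star_dotProduct_self_eq]
  have hRs : ‖R‖ ≤ |lam|⁻¹ * s := by
    rw [hR, inv_sub_eq_smul_inv hlc (hu _ (by rw [norm_inv]; exact inv_le_one_of_one_le₀ hlz)),
      norm_smul, norm_inv, Complex.norm_real, Real.norm_eq_abs]
    gcongr
    exact hs _ hlz
  have hs0 : 0 ≤ s := (norm_nonneg _).trans (hs _ hlz)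
  have hwn : ‖WithLp.toLp 2 w‖ ≤ |lam|⁻¹ * s * (‖M‖ * ‖WithLp.toLp 2 y‖) := by
    refine (norm_toLp_mulVec_le R (M *ᵥ y)).trans ?_
    gcongr
    exact norm_toLp_mulVec_le M y
  have hY : 0 < ‖WithLp.toLp 2 y‖ := by
    rw [norm_pos_iff]
    intro h
    exact hy (by simpa using congrArg WithLp.ofLp h)
  have hq := norm_star_dotProduct_mulVec_le X w
  set Q := star w ⬝ᵥ X *ᵥ w
  set Y := ‖WithLp.toLp 2 y‖
  set W := ‖WithLp.toLp 2 w‖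
  set P := ‖WithLp.toLp 2 (G *ᵥ w)‖
  have hl : 0 < |lam| := by linarith
  have hτq : τ * |lam| * |Q.re| < Y ^ 2 := calc
    τ * |lam| * |Q.re| ≤ τ * |lam| * (‖X‖ * (|lam|⁻¹ * s * (‖M‖ * Y)) ^ 2) := by
      gcongr
      refine (Complex.abs_re_le_norm Q).trans (hq.trans ?_)
      gcongr
    _ = |lam|⁻¹ * (τ * (‖X‖ * ‖M‖ ^ 2 * s ^ 2)) * Y ^ 2 := by
      field_simp
    _ ≤ 1 * (τ * (‖X‖ * ‖M‖ ^ 2 * s ^ 2)) * Y ^ 2 := by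
      gcongr
      exact inv_le_one_of_one_le₀ hlam
    _ < Y ^ 2 := by
      rw [one_mul]
      exact mul_lt_of_lt_one_left (by positivity) hb
  intro h0
  have hre : (lam - 1) * Y ^ 2 + τ * lam * ((lam - 1) * Q.re + P ^ 2) = 0 := by
    have h := congrArg Complex.re h0
    rw [← Complex.ofReal_one, ← Complex.ofReal_sub, ← Complex.ofReal_mul τ lam, Complex.add_re,
      Complex.re_ofReal_mul, Complex.re_ofReal_mul, Complex.add_re, Complex.re_ofReal_mul,
      Complex.ofReal_re, Complex.ofReal_re, Complex.zero_re] at h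
    exact h
  have hll : 0 ≤ lam * (lam - 1) := by
    rcases le_abs'.1 hlam with h | h <;> nlinarith
  have hpos : 0 < Y ^ 2 + τ * lam * Q.re := by
    have h : -(τ * lam * Q.re) ≤ τ * |lam| * |Q.re| := by
      rw [← abs_of_pos hτ, ← abs_mul, ← abs_mul, abs_of_pos hτ]
      exact neg_le_abs _
    linarith
  have hsq : 0 < (lam - 1) ^ 2 := by
    have := sub_ne_zero.2 h1
    positivity
  have h2 : (lam - 1) ^ 2 * (Y ^ 2 + τ * lam * Q.re) + τ * (lam * (lam - 1)) * P ^ 2 = 0 := by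
    linear_combination (lam - 1) * hre
  have h3 : 0 ≤ τ * (lam * (lam - 1)) * P ^ 2 := by positivity
  nlinarith [mul_pos hsq hpos]

theorem isUnit_one_sub_smul_pow {n : ℕ} {A : Matrix (Fin n) (Fin n) ℂ}
    (hρ : ∀ μ ∈ spectrum ℂ A, ‖μ‖ < 1) {k : ℕ} (hk : 0 < k) {w : ℂ} (hw : ‖w‖ ≤ 1) :
    IsUnit (1 - w • A ^ k) := by
  rcases eq_or_ne w 0 with rfl | h0
  · simp
  have hmem : w⁻¹ ∉ spectrum ℂ (A ^ k) := by
    rw [spectrum.map_pow_of_pos A hk]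
    rintro ⟨μ, hμ, he⟩
    have h1 : ‖μ ^ k‖ < 1 := by
      rw [norm_pow]
      exact pow_lt_one₀ (norm_nonneg _) (hρ μ hμ) hk.ne'
    have h2 : 1 ≤ ‖w⁻¹‖ := by
      rw [norm_inv]
      exact (one_le_inv₀ (norm_pos_iff.2 h0)).2 hw
    exact absurd (he ▸ h1) (not_lt.2 h2)
  rw [spectrum.notMem_iff, Algebra.algebraMap_eq_smul_one] at hmem
  have h := hmem.smul (Units.mk0 w h0)
  have he : Units.mk0 w h0 • (w⁻¹ • (1 : Matrix (Fin n) (Fin n) ℂ) - A ^ k) =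
      1 - w • A ^ k := by
    rw [Units.smul_def, Units.val_mk0, smul_sub, smul_smul, mul_inv_cancel₀ h0, one_smul]
  rwa [he] at h

theorem norm_inv_one_sub_smul_le_sSB {n : ℕ} {C : Matrix (Fin n) (Fin n) ℂ}
    (hu : ∀ w : ℂ, ‖w‖ ≤ 1 → IsUnit (1 - w • C)) {z : ℂ} (hz : 1 ≤ ‖z‖) :
    ‖(1 - z⁻¹ • C)⁻¹‖ ≤ sSB C := by
  refine le_csSup ?_ ⟨z, hz, rfl⟩
  have hc : ContinuousOn (fun w : ℂ => ‖(1 - w • C)⁻¹‖) (Metric.closedBall 0 1) := by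
    intro w hw
    apply ContinuousAt.continuousWithinAt
    obtain ⟨u, hu'⟩ := hu w (by simpa using hw)
    have h1 : ContinuousAt (fun w : ℂ => 1 - w • C) w := by fun_prop
    have h2 : ContinuousAt Ring.inverse (1 - w • C) := hu' ▸ NormedRing.inverse_continuousAt u
    have h3 := (h2.comp (f := fun w : ℂ => 1 - w • C) h1).norm
    simpa only [nonsing_inv_eq_ringInverse, Function.comp_def] using h3
  obtain ⟨K, hK⟩ := (isCompact_closedBall (0 : ℂ) 1).bddAbove_image hc
  refine ⟨K, ?_⟩
  rintro _ ⟨z', hz', rfl⟩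
  refine hK ⟨z'⁻¹, ?_, rfl⟩
  rw [mem_closedBall_zero_iff, norm_inv]
  exact inv_le_one_of_one_le₀ hz'

theorem sSB_le_inv_one_sub {n : ℕ} {C : Matrix (Fin n) (Fin n) ℂ}
    (hu : ∀ w : ℂ, ‖w‖ ≤ 1 → IsUnit (1 - w • C)) {c : ℝ} (hC : ‖C‖ ≤ c) (hc : c < 1) :
    sSB C ≤ (1 - c)⁻¹ := by
  refine csSup_le ⟨_, 1, by simp, rfl⟩ ?_
  rintro _ ⟨z, hz, rfl⟩
  rw [opNorm_eq_norm]
  have hz' : ‖z⁻¹‖ ≤ 1 := by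
    rw [norm_inv]
    exact inv_le_one_of_one_le₀ hz
  set R := (1 - z⁻¹ • C)⁻¹ with hR
  have hmul : (1 - z⁻¹ • C) * R = 1 :=
    mul_nonsing_inv _ ((isUnit_iff_isUnit_det _).1 (hu _ hz'))
  have heq : R = 1 + (z⁻¹ • C) * R := by
    rw [← hmul, sub_mul, one_mul, sub_add_cancel]
  have hle : ‖R‖ ≤ 1 + c * ‖R‖ := calc
    ‖R‖ = ‖1 + (z⁻¹ • C) * R‖ := by rw [← heq]
    _ ≤ ‖(1 : Matrix (Fin n) (Fin n) ℂ)‖ + ‖z⁻¹ • C‖ * ‖R‖ :=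
      (norm_add_le _ _).trans (by gcongr; exact norm_mul_le _ _)
    _ ≤ 1 + c * ‖R‖ := by
      gcongr
      · exact norm_one_le_one
      · rw [norm_smul]
        exact (mul_le_of_le_one_left (norm_nonneg _) hz').trans hC
  rw [← one_div, le_div_iff₀ (by linarith)]
  linarith

theorem norm_pow_le_pow_norm {n : ℕ} (A : Matrix (Fin n) (Fin n) ℝ) (i : ℕ) :
    ‖A ^ i‖ ≤ ‖A‖ ^ i := by
  rcases Nat.eq_zero_or_pos i with rfl | hi
  · simpa using norm_one_le_one
  · exact norm_pow_le' A hi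

theorem norm_transpose_eq {m n : ℕ} (A : Matrix (Fin m) (Fin n) ℝ) : ‖Aᵀ‖ = ‖A‖ := by
  rw [← conjTranspose_eq_transpose_of_trivial, l2_opNorm_conjTranspose]

theorem norm_Umat_le (B : Matrix (Fin nu) (Fin nu) ℝ) (H : Matrix (Fin nf) (Fin nu) ℝ) (l : ℕ) :
    ‖Umat B H l‖ ≤ ‖H‖ ^ 2 * (l * ‖B‖ ^ (l - 1)) := by
  have hterm : ∀ i ∈ Finset.range l, ‖Bᵀ ^ i * (Hᵀ * H) * B ^ (l - 1 - i)‖ ≤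
      ‖H‖ ^ 2 * ‖B‖ ^ (l - 1) := by
    intro i hi
    have hil : i + (l - 1 - i) = l - 1 := by
      have := Finset.mem_range.1 hi
      omega
    calc ‖Bᵀ ^ i * (Hᵀ * H) * B ^ (l - 1 - i)‖
        ≤ ‖Bᵀ ^ i‖ * (‖Hᵀ‖ * ‖H‖) * ‖B ^ (l - 1 - i)‖ := by
          refine (l2_opNorm_mul _ _).trans ?_
          gcongr
          refine (l2_opNorm_mul _ _).trans ?_
          gcongr
          exact l2_opNorm_mul _ _
      _ ≤ ‖B‖ ^ i * (‖H‖ * ‖H‖) * ‖B‖ ^ (l - 1 - i) := by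
          rw [norm_transpose_eq]
          gcongr
          · exact (norm_pow_le_pow_norm _ _).trans_eq (by rw [norm_transpose_eq])
          · exact norm_pow_le_pow_norm _ _
      _ = ‖H‖ ^ 2 * ‖B‖ ^ (l - 1) := by
          rw [mul_right_comm, ← pow_add, hil]
          ring
  refine (norm_sum_le_of_le _ hterm).trans_eq ?_
  rw [Finset.sum_const, Finset.card_range, nsmul_eq_mul]
  ring

theorem norm_Xmat_le (B : Matrix (Fin nu) (Fin nu) ℝ) (H : Matrix (Fin nf) (Fin nu) ℝ) (k : ℕ) :
    ‖Xmat B H k‖ ≤ ‖H‖ ^ 2 * ∑ l ∈ Finset.Ico 1 k, (l : ℝ) * ‖B‖ ^ (l - 1) := by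
  rw [Finset.mul_sum]
  exact norm_sum_le_of_le _ fun l _ => norm_Umat_le B H l

end L2OperatorNorm

theorem sum_Ico_mul_pow_pred_mul_sq (b : ℝ) {k : ℕ} (hk : 1 ≤ k) :
    (∑ l ∈ Finset.Ico 1 k, (l : ℝ) * b ^ (l - 1)) * (1 - b) ^ 2 =
      1 - (k : ℝ) * b ^ (k - 1) + ((k : ℝ) - 1) * b ^ k := by
  induction k, hk using Nat.le_induction with
  | base => simp
  | succ k hk ih =>
    obtain ⟨j, rfl⟩ := Nat.exists_eq_add_of_le' hk
    rw [Finset.sum_Ico_succ_top hk, add_mul, ih]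
    simp only [Nat.add_sub_cancel]
    push_cast
    ring

theorem opNorm_nonneg {𝕜 : Type*} [RCLike 𝕜] {m n : ℕ} (A : Matrix (Fin m) (Fin n) 𝕜) :
    0 ≤ opNorm A := norm_nonneg _

theorem opNorm_map_ofReal_le {m n : ℕ} (A : Matrix (Fin m) (Fin n) ℝ) :
    opNorm (A.map Complex.ofReal) ≤ opNorm A := norm_map_ofReal_le A

theorem sSB_nonneg {n : ℕ} (C : Matrix (Fin n) (Fin n) ℂ) : 0 ≤ sSB C :=
  Real.sSup_nonneg (by rintro _ ⟨z, -, rfl⟩; exact opNorm_nonneg _)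

theorem conjTranspose_map_ofReal {m n : ℕ} (A : Matrix (Fin m) (Fin n) ℝ) :
    (A.map Complex.ofReal)ᴴ = (A.map Complex.ofReal)ᵀ := by
  ext i j
  simp

theorem map_ofReal_mul {l m n : ℕ} (A : Matrix (Fin l) (Fin m) ℝ) (B : Matrix (Fin m) (Fin n) ℝ) :
    (A * B).map Complex.ofReal = A.map Complex.ofReal * B.map Complex.ofReal :=
  Matrix.map_mul (f := Complex.ofRealHom)

/-- real eigenvalues for the `k`-step one-shot method, `k ≥ 2`. -/
theorem k_step_one_shot_real_eigenvalues
    (B : Matrix (Fin nu) (Fin nu) ℝ) (M : Matrix (Fin nu) (Fin nσ) ℝ)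
    (H : Matrix (Fin nf) (Fin nu) ℝ)
    (hρ : ∀ μ ∈ spectrum ℂ (B.map Complex.ofReal), ‖μ‖ < 1)
    (k : ℕ) (hk : 2 ≤ k) :
    -- the eigenvalue-equation expression, for real λ and y ∈ ℂ^{nσ}
    let E : ℝ → (Fin nσ → ℂ) → ℝ → ℂ := fun lam y τ =>
      ((lam : ℂ) - 1) * (star y ⬝ᵥ y) +
        (τ : ℂ) * (lam : ℂ) * (star y ⬝ᵥ
          (((M.map Complex.ofReal)ᵀ *
              ((lam : ℂ) • (1 : Matrix (Fin nu) (Fin nu) ℂ) - ((Bᵀ) ^ k).map Complex.ofReal)⁻¹ *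
              (((lam : ℂ) - 1) • (Xmat B H k).map Complex.ofReal +
                ((Tmat B k)ᵀ * (Hᵀ * H) * Tmat B k).map Complex.ofReal) *
              ((lam : ℂ) • (1 : Matrix (Fin nu) (Fin nu) ℂ) - (B ^ k).map Complex.ofReal)⁻¹ *
              M.map Complex.ofReal) *ᵥ y))
    -- no real solution λ ≠ 1, |λ| ≥ 1, under the general bound on τ
    (∀ τ : ℝ, 0 < τ →
      τ * (opNorm (Xmat B H k) * opNorm M ^ 2 * sSB ((B ^ k).map Complex.ofReal) ^ 2) < 1 →
      ∀ lam : ℝ, lam ≠ 1 → 1 ≤ |lam| →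
        ∀ y : Fin nσ → ℂ, y ≠ 0 → E lam y τ ≠ 0) ∧
    -- moreover, when ‖B‖ < 1 an explicit bound suffices
    (opNorm B < 1 →
      ∀ τ : ℝ, 0 < τ →
      τ < ((1 - opNorm B) ^ 2 / (opNorm H ^ 2 * opNorm M ^ 2)) *
        ((1 - opNorm B ^ k) ^ 2 /
          (1 - (k : ℝ) * opNorm B ^ (k - 1) + ((k : ℝ) - 1) * opNorm B ^ k)) →
      ∀ lam : ℝ, lam ≠ 1 → 1 ≤ |lam| →
        ∀ y : Fin nσ → ℂ, y ≠ 0 → E lam y τ ≠ 0) := by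
  intro E
  have hpow : (B ^ k).map Complex.ofReal = B.map Complex.ofReal ^ k :=
    Matrix.map_pow B Complex.ofRealHom k
  have hu : ∀ w : ℂ, ‖w‖ ≤ 1 → IsUnit (1 - w • (B ^ k).map Complex.ofReal) := fun w hw => by
    rw [hpow]
    exact isUnit_one_sub_smul_pow hρ (by omega) hw
  have hmain : ∀ τ : ℝ, 0 < τ →
      τ * (opNorm (Xmat B H k) * opNorm M ^ 2 * sSB ((B ^ k).map Complex.ofReal) ^ 2) < 1 →
      ∀ lam : ℝ, lam ≠ 1 → 1 ≤ |lam| →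
        ∀ y : Fin nσ → ℂ, y ≠ 0 → E lam y τ ≠ 0 := by
    intro τ hτ hb lam h1 hlam y hy
    have hP : ((Tmat B k)ᵀ * (Hᵀ * H) * Tmat B k).map Complex.ofReal =
        ((H * Tmat B k).map Complex.ofReal)ᴴ * (H * Tmat B k).map Complex.ofReal := by
      rw [conjTranspose_map_ofReal, ← transpose_map, ← map_ofReal_mul, transpose_mul]
      simp only [Matrix.mul_assoc]
    have hC : ((Bᵀ) ^ k).map Complex.ofReal = ((B ^ k).map Complex.ofReal)ᴴ := by
      rw [conjTranspose_map_ofReal, ← transpose_map, transpose_pow]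
    simp only [E]
    rw [hP, hC, ← conjTranspose_map_ofReal]
    refine eigenvalue_expr_ne_zero _ _ _ _ hu
      (fun z hz => norm_inv_one_sub_smul_le_sSB hu hz) hτ (lt_of_le_of_lt ?_ hb) h1 hlam hy
    simp only [← opNorm_eq_norm]
    gcongr
    · exact opNorm_nonneg _
    · exact opNorm_map_ofReal_le _
    · exact opNorm_nonneg _
    · exact opNorm_map_ofReal_le _
  refine ⟨hmain, fun hB τ hτ hlt => hmain τ hτ ?_⟩
  have hb0 : 0 ≤ opNorm B := opNorm_nonneg B
  have hbk : opNorm B ^ k < 1 := pow_lt_one₀ hb0 hB (by omega)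
  have hs : sSB ((B ^ k).map Complex.ofReal) ≤ (1 - opNorm B ^ k)⁻¹ :=
    sSB_le_inv_one_sub hu ((norm_map_ofReal_le _).trans (norm_pow_le_pow_norm B k)) hbk
  have hs0 : 0 ≤ sSB ((B ^ k).map Complex.ofReal) :=
    sSB_nonneg _
  have hX : opNorm (Xmat B H k) ≤
      opNorm H ^ 2 * ∑ l ∈ Finset.Ico 1 k, (l : ℝ) * opNorm B ^ (l - 1) := norm_Xmat_le B H k
  rw [← sum_Ico_mul_pow_pred_mul_sq (opNorm B) (by omega : 1 ≤ k)] at hlt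
  have hN : 0 < ∑ l ∈ Finset.Ico 1 k, (l : ℝ) * opNorm B ^ (l - 1) := by
    refine Finset.sum_pos' (fun l _ => by positivity) ⟨1, by simp; omega, by simp⟩
  set N := ∑ l ∈ Finset.Ico 1 k, (l : ℝ) * opNorm B ^ (l - 1)
  have hH : opNorm H ≠ 0 := by
    intro h
    simp [h] at hlt
    linarith
  have hM : opNorm M ≠ 0 := by
    intro h
    simp [h] at hlt
    linarith
  have hr : 0 < 1 - opNorm B ^ k := by linarith
  have hb1 : 1 - opNorm B ≠ 0 := by linarith
  calc τ * (opNorm (Xmat B H k) * opNorm M ^ 2 * sSB ((B ^ k).map Complex.ofReal) ^ 2)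
      ≤ τ * (opNorm H ^ 2 * N * opNorm M ^ 2 * ((1 - opNorm B ^ k)⁻¹) ^ 2) := by gcongr
    _ < (1 - opNorm B) ^ 2 / (opNorm H ^ 2 * opNorm M ^ 2) *
          ((1 - opNorm B ^ k) ^ 2 / (N * (1 - opNorm B) ^ 2)) *
          (opNorm H ^ 2 * N * opNorm M ^ 2 * ((1 - opNorm B ^ k)⁻¹) ^ 2) := by
        gcongr
    _ = 1 := by
        field_simp
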